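/- Every OPE-algebra V is a bounded 𝕂̄-fold algebra: for all a,b∈V the distribution a(𝐳)b lies in V⌊𝐳⌋ (i.e. every Ya is a field on V), and a_(𝐧)b = 0 whenever 𝐧=(n,n̄) with n−n̄∉ℤ. Moreover, in any reduced OPE {c^i(𝐳,𝐰), 𝐡_i} of homogeneous a(𝐳), b(𝐳)∈F_Y, each c^i(𝐳,𝐰)c (c∈V) is supported in 𝕂̄×𝕂̄. -/

import Mathlib

open scoped BigOperators Classical

noncomputable section

namespace OPEA

variable (K : Type*) [Field K] [CharZero K]

/-- index pairs 𝐧 = (n, n̄) ∈ K² -/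
abbrev Idx := K × K

def IsInt (x : K) : Prop := ∃ k : ℤ, (k : K) = x

def IsNegInt (x : K) : Prop := ∃ k : ℤ, k < 0 ∧ (k : K) = x

/-- 𝕂̄ = {𝐧 ∈ K² | n − n̄ ∈ ℤ} -/
def Kbar (n : Idx K) : Prop := IsInt K (n.1 - n.2)

def IsIntPair (n : Idx K) : Prop := IsInt K n.1 ∧ IsInt K n.2

/-- generalized binomial coefficient C(x,k) -/
def gchoose (x : K) (k : ℕ) : K :=
  (∏ i ∈ Finset.range k, (x - (i : K))) / (k.factorial : K)

/-- (−1)^x for x an integer image in K (and 1 otherwise) -/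
def negOnePow (x : K) : K :=
  if h : ∃ k : ℤ, (k : K) = x then (-1 : K) ^ h.choose else 1

variable (M : Type*) [AddCommGroup M] [Module K M]

/-- M-valued distribution in one variable pair -/
abbrev Dist1 := Idx K → M

/-- M-valued distribution in two variable pairs -/
abbrev Dist2 := Idx K → Idx K → M

/-- M-valued distribution in r variable pairs -/
abbrev DistN (r : ℕ) := (Fin r → Idx K) → M

/-- membership in M[[𝐳]] -/
def IsPow1 (a : Dist1 K M) : Prop := ∀ n, a n ≠ 0 → IsNegInt K n.1 ∧ IsNegInt K n.2

/-- membership in M⌊𝐳⌋ -/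
def InLat1 (a : Dist1 K M) : Prop :=
  ∃ S : Finset (Idx K), ∀ n, a n ≠ 0 →
    ∃ m ∈ S, IsNegInt K (n.1 - m.1) ∧ IsNegInt K (n.2 - m.2)

/-- membership in M[[𝐳,𝐰]] -/
def IsPow2 (a : Dist2 K M) : Prop :=
  ∀ n k, a n k ≠ 0 →
    (IsNegInt K n.1 ∧ IsNegInt K n.2) ∧ (IsNegInt K k.1 ∧ IsNegInt K k.2)

/-- membership in M⌊𝐳,𝐰⌋ -/
def InLat2 (a : Dist2 K M) : Prop :=
  ∃ S : Finset (Idx K × Idx K), ∀ n k, a n k ≠ 0 →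
    ∃ m ∈ S, (IsNegInt K (n.1 - m.1.1) ∧ IsNegInt K (n.2 - m.1.2)) ∧
      (IsNegInt K (k.1 - m.2.1) ∧ IsNegInt K (k.2 - m.2.2))

/-- membership in M[[𝐳₁,…,𝐳ᵣ]] -/
def IsPowN {r : ℕ} (a : DistN K M r) : Prop :=
  ∀ n, a n ≠ 0 → ∀ i, IsNegInt K (n i).1 ∧ IsNegInt K (n i).2

/-- membership in M⌊𝐳₁,…,𝐳ᵣ⌋ -/
def InLatN {r : ℕ} (a : DistN K M r) : Prop :=
  ∃ S : Finset (Fin r → Idx K), ∀ n, a n ≠ 0 →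
    ∃ m ∈ S, ∀ i, IsNegInt K ((n i).1 - (m i).1) ∧ IsNegInt K ((n i).2 - (m i).2)

/-- ∂_z -/
def dz (a : Dist1 K M) : Dist1 K M := fun n => (-n.1) • a (n.1 - 1, n.2)

/-- ∂_z̄ -/
def dzb (a : Dist1 K M) : Dist1 K M := fun n => (-n.2) • a (n.1, n.2 - 1)

/-- ∂ in the first variable pair of a two-variable distribution (z-component) -/
def d1z (c : Dist2 K M) : Dist2 K M := fun n k => (-n.1) • c (n.1 - 1, n.2) k

/-- ∂ in the first variable pair of a two-variable distribution (z̄-component) -/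
def d1zb (c : Dist2 K M) : Dist2 K M := fun n k => (-n.2) • c (n.1, n.2 - 1) k

/-- divided power d^{(x)} of an operator d, for a K-valued exponent x
(zero unless x ∈ ℕ) -/
def dPow {A : Type*} [AddCommGroup A] [Module K A] (d : A → A) (x : K) (a : A) : A :=
  if h : ∃ j : ℕ, (j : K) = x then ((h.choose.factorial : K))⁻¹ • d^[h.choose] a else 0

/-- ∂_z^{(e_1)} ∂_z̄^{(e_2)} in the first variable pair -/
def ddPow2 (e : Idx K) (c : Dist2 K M) : Dist2 K M :=
  dPow K (d1z K M) e.1 (dPow K (d1zb K M) e.2 c)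

/-- the diagonal map c(𝐳,𝐰) ↦ c(𝐰,𝐰) -/
def diag (c : Dist2 K M) : Dist1 K M :=
  fun n => ∑ᶠ m : Idx K, c m (n.1 - m.1 - 1, n.2 - m.2 - 1)

/-- multiplication by (𝐳−𝐰)^h (expansion in z>w), on coefficients;
first index is 𝐳, second is 𝐰 -/
def zwPow (h : Idx K) (c : Dist2 K M) : Dist2 K M :=
  fun m k => ∑ᶠ i : ℕ × ℕ,
    ((-1 : K) ^ (i.1 + i.2) * gchoose K h.1 i.1 * gchoose K h.2 i.2) •
      c (m.1 + h.1 - i.1, m.2 + h.2 - i.2) (k.1 + i.1, k.2 + i.2)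

/-- multiplication by ((𝐳−𝐰)_{w>z})^h = (−1)^h (𝐰−𝐳)^h (expansion in w>z) -/
def zwPowW (h : Idx K) (c : Dist2 K M) : Dist2 K M :=
  fun m k => ∑ᶠ i : ℕ × ℕ,
    (negOnePow K (h.1 - h.2) * (-1 : K) ^ (i.1 + i.2) *
        gchoose K h.1 i.1 * gchoose K h.2 i.2) •
      c (m.1 + i.1, m.2 + i.2) (k.1 + h.1 - i.1, k.2 + h.2 - i.2)

/-- multiplication by (𝐱+𝐰)^N of a distribution d(𝐰,𝐱) (first index 𝐰, second 𝐱);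
the result is indexed by (x-index, w-index) -/
def xwPow (N : Idx K) (d : Dist2 K M) : Dist2 K M :=
  fun m k => ∑ᶠ i : ℕ × ℕ, (gchoose K N.1 i.1 * gchoose K N.2 i.2) •
    d (k.1 + i.1, k.2 + i.2) (m.1 + N.1 - i.1, m.2 + N.2 - i.2)

/-- multiplication by (𝐰+𝐱)^N of a distribution d(𝐰,𝐱) (first index 𝐰, second 𝐱);
the result is indexed by (x-index, w-index) -/
def wxPow (N : Idx K) (d : Dist2 K M) : Dist2 K M :=
  fun m k => ∑ᶠ i : ℕ × ℕ, (gchoose K N.1 i.1 * gchoose K N.2 i.2) •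
    d (k.1 + N.1 - i.1, k.2 + N.2 - i.2) (m.1 + i.1, m.2 + i.2)

/-- multiplication by 𝐱^A 𝐰^B (𝐱+𝐰)^N of p(𝐰,𝐱); result indexed (x-index, w-index) -/
def tripleXW (A B N : Idx K) (p : Dist2 K M) : Dist2 K M :=
  fun m k => ∑ᶠ l : ℕ × ℕ, (gchoose K N.1 l.1 * gchoose K N.2 l.2) •
    p (k.1 + B.1 + l.1, k.2 + B.2 + l.2) (m.1 + A.1 + N.1 - l.1, m.2 + A.2 + N.2 - l.2)

/-- multiplication by 𝐱^A 𝐰^B (𝐰+𝐱)^N of p(𝐰,𝐱); result indexed (x-index, w-index) -/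
def tripleWX (A B N : Idx K) (p : Dist2 K M) : Dist2 K M :=
  fun m k => ∑ᶠ l : ℕ × ℕ, (gchoose K N.1 l.1 * gchoose K N.2 l.2) •
    p (k.1 + B.1 + N.1 - l.1, k.2 + B.2 + N.2 - l.2) (m.1 + A.1 + l.1, m.2 + A.2 + l.2)

variable (E : Type*) [AddCommGroup E] [Module K E]

/-- End(E)-valued distributions in one variable pair -/
abbrev EDist1 := Dist1 K (Module.End K E)

/-- End(E)-valued distributions in two variable pairs -/
abbrev EDist2 := Dist2 K (Module.End K E)

/-- End(E)-valued distributions in r variable pairs -/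
abbrev EDistN (r : ℕ) := DistN K (Module.End K E) r

def ev1 (a : EDist1 K E) (v : E) : Dist1 K E := fun n => a n v

def ev2 (c : EDist2 K E) (v : E) : Dist2 K E := fun n k => c n k v

def evN {r : ℕ} (c : EDistN K E r) (v : E) : DistN K E r := fun n => c n v

/-- a(𝐳) is a field -/
def IsFieldD (a : EDist1 K E) : Prop := ∀ v, InLat1 K E (ev1 K E a v)

/-- a field in two variable pairs -/
def IsField2D (c : EDist2 K E) : Prop := ∀ v, InLat2 K E (ev2 K E c v)

/-- the Koszul sign (−1)^{pq} -/
def koszul (p q : ZMod 2) : K := if p = 1 ∧ q = 1 then (-1 : K) else 1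

/-- the data (c^i, 𝐡_i) is an OPE of the homogeneous distributions a(𝐳), b(𝐳)
of parities pa, pb (all identities to be read applied to each vector of E) -/
def IsOPE (pa pb : ZMod 2) (a b : EDist1 K E) {r : ℕ}
    (c : Fin r → EDist2 K E) (h : Fin r → Idx K) : Prop :=
  (∀ i, Kbar K (h i)) ∧ (∀ i, IsField2D K E (c i)) ∧
  (∀ v m k, a m (b k v) = ∑ i, zwPow K E (-(h i)) (ev2 K E (c i) v) m k) ∧
  (∀ v m k, koszul K pa pb • (b k (a m v)) =
      ∑ i, zwPowW K E (-(h i)) (ev2 K E (c i) v) m k)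

/-- a(𝐳), b(𝐳) (homogeneous of parities pa, pb) are local -/
def IsLocal (pa pb : ZMod 2) (a b : EDist1 K E) : Prop :=
  ∃ (r : ℕ) (c : Fin r → EDist2 K E) (h : Fin r → Idx K), IsOPE K E pa pb a b c h

/-- the exponents of an OPE are reduced: 𝐡_i ∉ 𝐡_j + ℤ² for i ≠ j -/
def ReducedExp {r : ℕ} (h : Fin r → Idx K) : Prop :=
  ∀ i j, i ≠ j → ¬ IsIntPair K (h i - h j)

/-- the product field a(𝐰)_{(𝐧)}b(𝐰) built from an OPE (c,h), applied to a vector v -/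
def prodAt {r : ℕ} (c : Fin r → EDist2 K E) (h : Fin r → Idx K) (n : Idx K)
    (v : E) : Dist1 K E :=
  fun m => ∑ i, diag K E
    (ddPow2 K E ((h i).1 - 1 - n.1, (h i).2 - 1 - n.2) (ev2 K E (c i) v)) m

/-- s₁ : a(𝐳) ↦ a_{(−1,−1)}1 -/
def s1 (one : E) (a : EDist1 K E) : E := a ((-1 : K), (-1 : K)) one

/-- the distribution d (to be thought of as a(𝐳)1) equals
Σ_{𝐢∈ℕ²} T^{(i)} T̄^{(ī)} (d_{(−1,−1)}) 𝐳^𝐢, i.e. a(𝐳) is creative -/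
def CreativeD (T Tb : Module.End K E) (d : Dist1 K E) : Prop :=
  (∀ i : ℕ × ℕ, d (-(i.1 : K) - 1, -(i.2 : K) - 1) =
      ((i.1.factorial : K)⁻¹ * (i.2.factorial : K)⁻¹) •
        ((T ^ i.1) * (Tb ^ i.2)) (d ((-1 : K), (-1 : K)))) ∧
  (∀ n : Idx K, (¬ ∃ i : ℕ × ℕ, n = (-(i.1 : K) - 1, -(i.2 : K) - 1)) → d n = 0)

/-- a(𝐳) is translation covariant for (T, T̄) -/
def TransCov (T Tb : Module.End K E) (a : EDist1 K E) : Prop :=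
  (∀ n : Idx K, T * a n - a n * T = (-n.1) • a (n.1 - 1, n.2)) ∧
  (∀ n : Idx K, Tb * a n - a n * Tb = (-n.2) • a (n.1, n.2 - 1))

/-- translation covariance of a product field, per vector -/
def TransCovAt (T Tb : Module.End K E) (P : E → Dist1 K E) : Prop :=
  (∀ v (m : Idx K), T (P v m) - P (T v) m = (-m.1) • P v (m.1 - 1, m.2)) ∧
  (∀ v (m : Idx K), Tb (P v m) - P (Tb v) m = (-m.2) • P v (m.1, m.2 - 1))

/-- the identity field 1(z) = id_E -/
def idField : EDist1 K E :=
  fun n => if n = ((-1 : K), (-1 : K)) then (1 : Module.End K E) else 0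

/-- pairs i < j in [r] -/
abbrev Pairs (r : ℕ) := {p : Fin r × Fin r // p.1 < p.2}

/-- the index shift of the i-th variable produced by the monomial of a binomial
expansion of ((𝐳_{p₁} − 𝐳_{p₂})_σ)^h belonging to 𝐤 ∈ ℕ² -/
def pairShift {r : ℕ} (p : Pairs r) (h : Idx K) (flip : Bool) (kk : ℕ × ℕ)
    (i : Fin r) : Idx K :=
  if i = p.1.1 then
    (if flip then ((kk.1 : K), (kk.2 : K)) else (h.1 - kk.1, h.2 - kk.2))
  else if i = p.1.2 then
    (if flip then (h.1 - kk.1, h.2 - kk.2) else ((kk.1 : K), (kk.2 : K)))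
  else 0

/-- the coefficient of a binomial expansion of ((𝐳_{p₁} − 𝐳_{p₂})_σ)^h
belonging to 𝐤 ∈ ℕ² -/
def pairCoef (h : Idx K) (flip : Bool) (kk : ℕ × ℕ) : K :=
  (if flip then negOnePow K (h.1 - h.2) else 1) * (-1 : K) ^ (kk.1 + kk.2) *
    gchoose K h.1 kk.1 * gchoose K h.2 kk.2

def flipOf {r : ℕ} (σ : Equiv.Perm (Fin r)) (p : Pairs r) : Bool :=
  decide (σ.symm p.1.2 < σ.symm p.1.1)

/-- multiplication by Π_{i<j} ((𝐳_i − 𝐳_j)_σ)^{h_{ij}} on an r-variable distribution -/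
def permMul {r : ℕ} (σ : Equiv.Perm (Fin r)) (hs : Pairs r → Idx K)
    (c : DistN K M r) : DistN K M r :=
  fun m => ∑ᶠ κ : Pairs r → ℕ × ℕ,
    (∏ p : Pairs r, pairCoef K (hs p) (flipOf σ p) (κ p)) •
      c (fun i => m i + ∑ p : Pairs r, pairShift K p (hs p) (flipOf σ p) (κ p) i)

/-- the Koszul sign ζ' produced by reordering a¹,…,aʳ into a^{σ1},…,a^{σr} -/
def koszulPerm {r : ℕ} (ps : Fin r → ZMod 2) (σ : Equiv.Perm (Fin r)) : K :=
  ∏ p : Pairs r,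
    if σ.symm p.1.2 < σ.symm p.1.1 ∧ ps p.1.1 = 1 ∧ ps p.1.2 = 1 then (-1 : K) else 1

/-- the composition a^{σ1}(𝐳_{σ1})_{m_{σ1}} ∘ ⋯ ∘ a^{σr}(𝐳_{σr})_{m_{σr}} applied to v -/
def compSeq {r : ℕ} (a : Fin r → EDist1 K E) (σ : Equiv.Perm (Fin r))
    (m : Fin r → Idx K) (v : E) : E :=
  (List.ofFn fun j : Fin r => σ j).foldr (fun i acc => a i (m i) acc) v

/-- the data (c^α, 𝐡_{ij}^k) is a (multiple) OPE of the homogeneous distributions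
a¹(𝐳),…,aʳ(𝐳) of parities ps -/
def IsMultOPE {r : ℕ} (a : Fin r → EDist1 K E) (ps : Fin r → ZMod 2)
    (rij : Fin r → Fin r → ℕ) (hs : ∀ i j : Fin r, Fin (rij i j) → Idx K)
    (c : ((p : Pairs r) → Fin (rij p.1.1 p.1.2)) → EDistN K E r) : Prop :=
  (∀ i j k, Kbar K (hs i j k)) ∧
  (∀ α v, InLatN K E (evN K E (c α) v)) ∧
  (∀ σ : Equiv.Perm (Fin r), ∀ v m,
    koszulPerm K ps σ • compSeq K E a σ m v =
      ∑ α : (p : Pairs r) → Fin (rij p.1.1 p.1.2),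
        permMul K E σ (fun p => -(hs p.1.1 p.1.2 (α p))) (evN K E (c α) v) m)

/-- a¹(𝐳),…,aʳ(𝐳) are multiply local -/
def MultiplyLocal {r : ℕ} (a : Fin r → EDist1 K E) (ps : Fin r → ZMod 2) : Prop :=
  ∃ (rij : Fin r → Fin r → ℕ) (hs : ∀ i j : Fin r, Fin (rij i j) → Idx K)
    (c : ((p : Pairs r) → Fin (rij p.1.1 p.1.2)) → EDistN K E r),
      IsMultOPE K E a ps rij hs c

/-- a set of homogeneous fields (with parities pF) is multiply local -/
def MultLocalSet (F : Set (EDist1 K E)) (pF : EDist1 K E → ZMod 2) : Prop :=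
  ∀ (r : ℕ) (f : Fin r → EDist1 K E), (∀ i, f i ∈ F) →
    MultiplyLocal K E f (fun i => pF (f i))

/-- a set of homogeneous fields (with parities pF) is uniformly local -/
def UnifLocalSet (F : Set (EDist1 K E)) (pF : EDist1 K E → ZMod 2) (one : E) : Prop :=
  ∃ (rr : EDist1 K E → EDist1 K E → ℕ)
    (hh : ∀ d e : EDist1 K E, Fin (rr d e) → Idx K),
    ∀ (r : ℕ) (f : Fin r → EDist1 K E), (∀ i, f i ∈ F) →
      ∃ c, IsMultOPE K E f (fun i => pF (f i)) (fun i j => rr (f i) (f j))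
          (fun i j => hh (f i) (f j)) c ∧
        ∀ α, IsPowN K E (evN K E (c α) one)

/-- a ∈ V is homogeneous of parity p w.r.t. the grading (ev, od) -/
def memPar {V : Type*} [AddCommGroup V] [Module K V] (ev od : Submodule K V)
    (a : V) (p : ZMod 2) : Prop :=
  (p = 0 ∧ a ∈ ev) ∨ (p = 1 ∧ a ∈ od)

/-- an endomorphism is homogeneous of parity p w.r.t. the grading (ev, od) -/
def EndPar {V : Type*} [AddCommGroup V] [Module K V] (ev od : Submodule K V)
    (f : Module.End K V) (p : ZMod 2) : Prop :=
  if p = 0 then (∀ v ∈ ev, f v ∈ ev) ∧ (∀ v ∈ od, f v ∈ od)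
  else (∀ v ∈ ev, f v ∈ od) ∧ (∀ v ∈ od, f v ∈ ev)

/-- a distribution is homogeneous of parity p -/
def EDistPar {V : Type*} [AddCommGroup V] [Module K V] (ev od : Submodule K V)
    (a : EDist1 K V) (p : ZMod 2) : Prop :=
  ∀ n, EndPar K ev od (a n) p

end OPEA

namespace OPEA

/-- an OPE-algebra -/
structure OPEAlg (K : Type*) [Field K] [CharZero K]
    (V : Type*) [AddCommGroup V] [Module K V] where
  ev : Submodule K V
  od : Submodule K V
  compl : IsCompl ev od
  Y : V →ₗ[K] EDist1 K V
  Y_par : ∀ a p, memPar K ev od a p → ∀ (n : Idx K) b q, memPar K ev od b q →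
    memPar K ev od (Y a n b) (p + q)
  one : V
  one_ev : one ∈ ev
  T : Module.End K V
  Tb : Module.End K V
  T_ev : EndPar K ev od T 0
  Tb_ev : EndPar K ev od Tb 0
  commTTb : T * Tb = Tb * T
  T_one : T one = 0
  Tb_one : Tb one = 0
  wcre : ∀ a, IsPow1 K V (ev1 K V (Y a) one)
  rid : ∀ a, Y a ((-1 : K), (-1 : K)) one = a
  tcov : ∀ a, TransCov K V T Tb (Y a)
  loc : ∀ a b pa pb, memPar K ev od a pa → memPar K ev od b pb →
    IsLocal K V pa pb (Y a) (Y b)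

/-- a bounded 𝕂̄-fold algebra -/
structure BFold (K : Type*) [Field K] [CharZero K]
    (V : Type*) [AddCommGroup V] [Module K V] where
  ev : Submodule K V
  od : Submodule K V
  compl : IsCompl ev od
  Y : V →ₗ[K] EDist1 K V
  Y_par : ∀ a p, memPar K ev od a p → ∀ (n : Idx K) b q, memPar K ev od b q →
    memPar K ev od (Y a n b) (p + q)
  fields : ∀ a, IsFieldD K V (Y a)
  bounded : ∀ a (n : Idx K), ¬ Kbar K n → ∀ b, Y a n b = 0

/-- a bounded 𝕂̄-fold module over a bounded 𝕂̄-fold algebra -/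
structure BMod (K : Type*) [Field K] [CharZero K]
    (V : Type*) [AddCommGroup V] [Module K V] (A : BFold K V)
    (Mo : Type*) [AddCommGroup Mo] [Module K Mo] where
  evM : Submodule K Mo
  odM : Submodule K Mo
  complM : IsCompl evM odM
  YM : V →ₗ[K] EDist1 K Mo
  YM_par : ∀ a p, memPar K A.ev A.od a p → ∀ n : Idx K, EndPar K evM odM (YM a n) p
  fieldsM : ∀ a, IsFieldD K Mo (YM a)
  boundedM : ∀ a (n : Idx K), ¬ Kbar K n → ∀ c, YM a n c = 0

variable (K : Type*) [Field K] [CharZero K]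
variable (V : Type*) [AddCommGroup V] [Module K V]
variable (Mo : Type*) [AddCommGroup Mo] [Module K Mo]

/-- the operator T₁ : a ↦ a_{(−2,−1)}1 of an OPE-algebra -/
def T1 (A : OPEAlg K V) : Module.End K V where
  toFun := fun a => A.Y a ((-2 : K), (-1 : K)) A.one
  map_add' := by
    intro x y
    simp [map_add, Pi.add_apply, LinearMap.add_apply]
  map_smul' := by
    intro c x
    simp [map_smul, Pi.smul_apply, LinearMap.smul_apply]

/-- the operator T̄₁ : a ↦ a_{(−1,−2)}1 of an OPE-algebra -/
def T1b (A : OPEAlg K V) : Module.End K V where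
  toFun := fun a => A.Y a ((-1 : K), (-2 : K)) A.one
  map_add' := by
    intro x y
    simp [map_add, Pi.add_apply, LinearMap.add_apply]
  map_smul' := by
    intro c x
    simp [map_smul, Pi.smul_apply, LinearMap.smul_apply]

/-- skew-symmetry for the pair (T, T̄) -/
def SkewSym (ev od : Submodule K V) (Yf : V → EDist1 K V)
    (T Tb : Module.End K V) : Prop :=
  ∀ a b pa pb, memPar K ev od a pa → memPar K ev od b pb →
    ∀ n : Idx K, Kbar K n →
      (Function.support (fun i : ℕ × ℕ =>
        ((i.1.factorial : K)⁻¹ * (i.2.factorial : K)⁻¹ *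
            negOnePow K (n.1 + i.1 - (n.2 + i.2))) •
          ((T ^ i.1) * (Tb ^ i.2)) (Yf a (n.1 + i.1, n.2 + i.2) b))).Finite ∧
      koszul K pa pb • Yf b n a =
        ∑ᶠ i : ℕ × ℕ, ((i.1.factorial : K)⁻¹ * (i.2.factorial : K)⁻¹ *
            negOnePow K (n.1 + i.1 - (n.2 + i.2))) •
          ((T ^ i.1) * (Tb ^ i.2)) (Yf a (n.1 + i.1, n.2 + i.2) b)

/-- (T, T̄) is a translation endomorphism of the module with state-field map YM -/
def TransEnd (YM : V → EDist1 K Mo) (T Tb : Module.End K V) : Prop :=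
  (∀ a (n : Idx K), YM (T a) n = (-n.1) • YM a (n.1 - 1, n.2)) ∧
  (∀ a (n : Idx K), YM (Tb a) n = (-n.2) • YM a (n.1, n.2 - 1))

/-- the coefficient at (x-index m, w-index k) of a(𝐱+𝐰) applied to the w-distribution bw -/
def lhsXW (YM : V → EDist1 K Mo) (a : V) (bw : Dist1 K Mo) (m k : Idx K) : Mo :=
  ∑ᶠ i : ℕ × ℕ, ((i.1.factorial : K)⁻¹ * (i.2.factorial : K)⁻¹) •
    (((dz K (Module.End K Mo))^[i.1] ((dzb K (Module.End K Mo))^[i.2] (YM a))) m)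
      (bw (k.1 + i.1, k.2 + i.2))

/-- a and cM are dual in the direct channel -/
def DualDirect (Y : V → EDist1 K V) (YM : V → EDist1 K Mo) (a : V) (cM : Mo) : Prop :=
  ∃ (s : ℕ) (d : Fin s → Idx K → Idx K → (V →ₗ[K] Mo)) (hj : Fin s → Idx K),
    (∀ j, Kbar K (hj j)) ∧
    (∀ j b, InLat2 K Mo (fun kw mx => d j kw mx b)) ∧
    (∀ b (m k : Idx K),
      lhsXW K V Mo YM a (fun k' => YM b k' cM) m k =
        ∑ j, xwPow K Mo (-(hj j)) (fun kw mx => d j kw mx b) m k) ∧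
    (∀ b (m k : Idx K),
      YM (Y a m b) k cM =
        ∑ j, wxPow K Mo (-(hj j)) (fun kw mx => d j kw mx b) m k)

/-- a and b are dual in the exchange channel on the module -/
def DualExch (Y : V → EDist1 K V) (YM : V → EDist1 K Mo) (a b : V) : Prop :=
  ∃ (r : ℕ) (hab : Fin r → Idx K), (∀ i, Kbar K (hab i)) ∧
    ∀ cM : Mo, ∃ (s : ℕ) (hac : Fin s → Idx K)
      (q : Fin r → Fin s → Idx K → Idx K → Mo),
      (∀ j, Kbar K (hac j)) ∧
      (∀ i j kw mx, q i j kw mx ≠ 0 → IsNegInt K mx.1 ∧ IsNegInt K mx.2) ∧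
      (∀ i j mx, InLat1 K Mo (fun kw => q i j kw mx)) ∧
      (∀ m k : Idx K,
        lhsXW K V Mo YM a (fun k' => YM b k' cM) m k =
          ∑ j, xwPow K Mo (-(hac j))
            (fun kw mx => ∑ i, q i j kw (mx.1 - (hab i).1, mx.2 - (hab i).2)) m k) ∧
      (∀ m k : Idx K,
        YM (Y a m b) k cM =
          ∑ j, wxPow K Mo (-(hac j))
            (fun kw mx => ∑ i, q i j kw (mx.1 - (hab i).1, mx.2 - (hab i).2)) m k)

/-- the module with state-field map YM is dual -/
def IsDualMod (ev od : Submodule K V) (Y : V → EDist1 K V) (YM : V → EDist1 K Mo) : Prop :=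
  ∃ (rVV : V → V → ℕ) (hVV : ∀ a b : V, Fin (rVV a b) → Idx K)
    (rVM : V → Mo → ℕ) (hVM : ∀ (a : V) (c : Mo), Fin (rVM a c) → Idx K),
    (∀ a b i, Kbar K (hVV a b i)) ∧ (∀ a c j, Kbar K (hVM a c j)) ∧
    ∀ a b pa pb, memPar K ev od a pa → memPar K ev od b pb → ∀ c : Mo,
      ∃ p : Fin (rVV a b) → Fin (rVM a c) → Fin (rVM b c) → Dist2 K Mo,
        (∀ i j k, IsPow2 K Mo (p i j k)) ∧
        (∀ m k : Idx K,
          lhsXW K V Mo YM a (fun k' => YM b k' c) m k =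
            ∑ i, ∑ j, ∑ kk, tripleXW K Mo (-(hVV a b i)) (-(hVM b c kk))
              (-(hVM a c j)) (p i j kk) m k) ∧
        (∀ m k : Idx K,
          YM (Y a m b) k c =
            ∑ i, ∑ j, ∑ kk, tripleWX K Mo (-(hVV a b i)) (-(hVM b c kk))
              (-(hVM a c j)) (p i j kk) m k)

/-- F_Y is multiply local -/
def MultLocalAlg (A : OPEAlg K V) : Prop :=
  ∀ (r : ℕ) (f : Fin r → V) (pf : Fin r → ZMod 2),
    (∀ i, memPar K A.ev A.od (f i) (pf i)) →
      MultiplyLocal K V (fun i => A.Y (f i)) pf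

/-- F_Y is uniformly local -/
def UnifLocalAlg (A : OPEAlg K V) : Prop :=
  ∃ (rr : V → V → ℕ) (hh : ∀ a b : V, Fin (rr a b) → Idx K),
    ∀ (r : ℕ) (f : Fin r → V) (pf : Fin r → ZMod 2),
      (∀ i, memPar K A.ev A.od (f i) (pf i)) →
        ∃ c, IsMultOPE K V (fun i => A.Y (f i)) pf (fun i j => rr (f i) (f j))
            (fun i j => hh (f i) (f j)) c ∧
          ∀ α, IsPowN K V (evN K V (c α) A.one)

end OPEA
namespace OPEA

section Multiplication

set_option linter.unusedSectionVars false

variable {K : Type*} [Field K] [CharZero K] {M : Type*} [AddCommGroup M] [Module K M]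

lemma gchoose_zero (x : K) : gchoose K x 0 = 1 := by simp [gchoose]

lemma gchoose_succ_mul (x : K) (l : ℕ) :
    gchoose K x (l + 1) * (l + 1) = gchoose K x l * (x - l) := by
  have h₁ : ((l : K) + 1) ≠ 0 := by exact_mod_cast l.succ_ne_zero
  have h₂ : (l.factorial : K) ≠ 0 := by exact_mod_cast l.factorial_ne_zero
  simp only [gchoose, Finset.prod_range_succ, Nat.factorial_succ, Nat.cast_mul, Nat.cast_add,
    Nat.cast_one]
  field_simp

lemma gchoose_add_one (x : K) (l : ℕ) :
    gchoose K (x + 1) (l + 1) = gchoose K x (l + 1) + gchoose K x l := by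
  have h₁ : ((l : K) + 1) ≠ 0 := by exact_mod_cast l.succ_ne_zero
  have h₂ : (l.factorial : K) ≠ 0 := by exact_mod_cast l.factorial_ne_zero
  have h₃ : ∏ i ∈ Finset.range (l + 1), (x + 1 - (i : K)) =
      (∏ i ∈ Finset.range l, (x - (i : K))) * (x + 1) := by
    rw [Finset.prod_range_succ']
    simp
  simp only [gchoose, h₃]
  simp only [Finset.prod_range_succ, Nat.factorial_succ, Nat.cast_mul, Nat.cast_add,
    Nat.cast_one]
  field_simp
  ring

lemma isInt_sub {x y : K} (hx : IsInt K x) (hy : IsInt K y) : IsInt K (x - y) := by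
  obtain ⟨a, rfl⟩ := hx
  obtain ⟨b, rfl⟩ := hy
  exact ⟨a - b, by push_cast; ring⟩

lemma isInt_add {x y : K} (hx : IsInt K x) (hy : IsInt K y) : IsInt K (x + y) := by
  obtain ⟨a, rfl⟩ := hx
  obtain ⟨b, rfl⟩ := hy
  exact ⟨a + b, by push_cast; ring⟩

lemma isInt_intCast (a : ℤ) : IsInt K (a : K) := ⟨a, rfl⟩

lemma isInt_natCast (a : ℕ) : IsInt K (a : K) := ⟨a, by simp⟩

lemma isInt_add_iff {x y : K} (hy : IsInt K y) : IsInt K (x + y) ↔ IsInt K x :=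
  ⟨fun h => by simpa using isInt_sub h hy, fun h => isInt_add h hy⟩

lemma IsNegInt.isInt {x : K} (hx : IsNegInt K x) : IsInt K x := by
  obtain ⟨a, _, rfl⟩ := hx
  exact ⟨a, rfl⟩

lemma kbar_add_iff {d : Idx K} (hd : Kbar K d) (n : Idx K) : Kbar K (n + d) ↔ Kbar K n := by
  rw [Kbar, Prod.fst_add, Prod.snd_add, add_sub_add_comm]
  exact isInt_add_iff hd

lemma kbar_natCast (p q : ℕ) : Kbar K ((p : K), (q : K)) :=
  isInt_sub (isInt_natCast p) (isInt_natCast q)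

lemma Kbar.neg {d : Idx K} (hd : Kbar K d) : Kbar K (-d) := by
  simpa [Kbar, neg_add_eq_sub] using isInt_sub (isInt_natCast 0) hd

lemma negOnePow_intCast (a : ℤ) : negOnePow K (a : K) = (-1) ^ a := by
  have h : ∃ k : ℤ, (k : K) = (a : K) := ⟨a, rfl⟩
  rw [negOnePow, dif_pos h, Int.cast_injective h.choose_spec]

lemma negOnePow_ne_zero {x : K} (hx : IsInt K x) : negOnePow K x ≠ 0 := by
  obtain ⟨a, rfl⟩ := hx
  rw [negOnePow_intCast]
  exact zpow_ne_zero _ (by simp)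

lemma negOnePow_add_natCast_sub {x : K} (hx : IsInt K x) (p q : ℕ) :
    negOnePow K (x + (p - q)) = negOnePow K x * (-1) ^ (p + q) := by
  obtain ⟨a, rfl⟩ := hx
  have : ((a : K) + (p - q)) = ((a + (p - q) : ℤ) : K) := by push_cast; ring
  rw [this, negOnePow_intCast, negOnePow_intCast, zpow_add₀ (by simp), zpow_sub₀ (by simp), pow_add]
  congr 1
  rw [zpow_natCast, zpow_natCast, div_eq_mul_inv, ← inv_pow]
  norm_num

lemma exists_bound_isNegInt (x : K) : ∃ N : ℕ, ∀ l : ℤ, IsNegInt K (x + l) → l < N := by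
  by_cases hx : IsInt K x
  · obtain ⟨a, rfl⟩ := hx
    refine ⟨a.natAbs, fun l hl => ?_⟩
    obtain ⟨j, hj, hjl⟩ := hl
    have : j = a + l := by exact_mod_cast hjl
    omega
  · exact ⟨0, fun l hl => absurd ((isInt_add_iff (isInt_intCast l)).1 hl.isInt) hx⟩

/-- Exchange of the two variable pairs. -/
def swapVars (c : Dist2 K M) : Dist2 K M := fun n k => c k n

/-- Exchange of the holomorphic and the antiholomorphic variables. -/
def swapBar (c : Dist2 K M) : Dist2 K M := fun n k => c n.swap k.swap

lemma InLat2.swapVars {c : Dist2 K M} (hc : InLat2 K M c) : InLat2 K M (swapVars c) := by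
  obtain ⟨S, hS⟩ := hc
  refine ⟨S.image Prod.swap, fun n k h => ?_⟩
  obtain ⟨m, hm, h₁, h₂⟩ := hS k n h
  exact ⟨m.swap, Finset.mem_image_of_mem _ hm, h₂, h₁⟩

lemma InLat2.swapBar {c : Dist2 K M} (hc : InLat2 K M c) : InLat2 K M (swapBar c) := by
  obtain ⟨S, hS⟩ := hc
  refine ⟨S.image fun m => (m.1.swap, m.2.swap), fun n k h => ?_⟩
  obtain ⟨m, hm, h₁, h₂⟩ := hS _ _ h
  exact ⟨_, Finset.mem_image_of_mem _ hm, h₁.symm, h₂.symm⟩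

lemma InLat2.zero : InLat2 K M 0 := ⟨∅, fun _ _ h => absurd rfl h⟩

lemma InLat2.add {c d : Dist2 K M} (hc : InLat2 K M c) (hd : InLat2 K M d) :
    InLat2 K M (c + d) := by
  obtain ⟨S, hS⟩ := hc
  obtain ⟨S', hS'⟩ := hd
  refine ⟨S ∪ S', fun n k h => ?_⟩
  by_cases h₀ : c n k = 0
  · have : d n k ≠ 0 := by simpa [h₀] using h
    obtain ⟨m, hm, H⟩ := hS' n k this
    exact ⟨m, Finset.mem_union_right _ hm, H⟩
  · obtain ⟨m, hm, H⟩ := hS n k h₀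
    exact ⟨m, Finset.mem_union_left _ hm, H⟩

lemma InLat2.sum {ι : Type*} (s : Finset ι) {c : ι → Dist2 K M}
    (hc : ∀ i ∈ s, InLat2 K M (c i)) : InLat2 K M (∑ i ∈ s, c i) :=
  Finset.sum_induction _ _ (fun _ _ => InLat2.add) InLat2.zero hc

lemma InLat2.smul {c : Dist2 K M} (hc : InLat2 K M c) (x : K) : InLat2 K M (x • c) := by
  obtain ⟨S, hS⟩ := hc
  refine ⟨S, fun n k h => hS n k fun h₀ => h ?_⟩
  simp [h₀]

lemma InLat2.trunc {c : Dist2 K M} (hc : InLat2 K M c) (P : Idx K → Idx K → Prop) :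
    InLat2 K M (fun n k => if P n k then 0 else c n k) := by
  obtain ⟨S, hS⟩ := hc
  refine ⟨S, fun n k h => hS n k fun h₀ => h ?_⟩
  simp [h₀]

lemma InLat2.shift {c : Dist2 K M} (hc : InLat2 K M c) (p q : Idx K) :
    InLat2 K M (fun n k => c (n + p) (k + q)) := by
  obtain ⟨S, hS⟩ := hc
  refine ⟨S.image fun m => (m.1 - p, m.2 - q), fun n k h => ?_⟩
  obtain ⟨m, hm, H⟩ := hS _ _ h
  refine ⟨_, Finset.mem_image_of_mem _ hm, ?_⟩
  simpa [sub_sub_eq_add_sub] using H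

lemma InLat2.exists_bound_right {c : Dist2 K M} (hc : InLat2 K M c) (k : Idx K) :
    ∃ N : ℕ, ∀ (n : Idx K) (l l' : ℤ), c n (k.1 + l, k.2 + l') ≠ 0 → l < N ∧ l' < N := by
  obtain ⟨S, hS⟩ := hc
  choose f hf using fun x : K => exists_bound_isNegInt x
  refine ⟨S.sup fun m => max (f (k.1 - m.2.1)) (f (k.2 - m.2.2)), fun n l l' h => ?_⟩
  obtain ⟨m, hm, -, h₁, h₂⟩ := hS _ _ h
  have hle := Finset.le_sup (f := fun m => max (f (k.1 - m.2.1)) (f (k.2 - m.2.2))) hm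
  have h₃ := hf (k.1 - m.2.1) l (by simpa [sub_add_eq_add_sub] using h₁)
  have h₄ := hf (k.2 - m.2.2) l' (by simpa [sub_add_eq_add_sub] using h₂)
  constructor <;> omega

lemma InLat2.exists_bound_left {c : Dist2 K M} (hc : InLat2 K M c) (n : Idx K) :
    ∃ N : ℕ, ∀ (k : Idx K) (l l' : ℤ), c (n.1 + l, n.2 + l') k ≠ 0 → l < N ∧ l' < N :=
  hc.swapVars.exists_bound_right n

lemma InLat2.exists_bound_nat {c : Dist2 K M} (hc : InLat2 K M c) (k : Idx K) :
    ∃ N : ℕ, ∀ (n : Idx K) (i : ℕ × ℕ), c n (k.1 + i.1, k.2 + i.2) ≠ 0 → i.1 < N ∧ i.2 < N := by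
  obtain ⟨N, hN⟩ := hc.exists_bound_right k
  refine ⟨N, fun n i h => ?_⟩
  have := hN n i.1 i.2 (by simpa using h)
  omega

/-- The coefficient of `z^{h-i} w^i` in `(z-w)^h`. -/
def zwCoef (h : Idx K) (i : ℕ × ℕ) : K :=
  (-1 : K) ^ (i.1 + i.2) * gchoose K h.1 i.1 * gchoose K h.2 i.2

lemma InLat2.zwPow_eq_sum {c : Dist2 K M} (hc : InLat2 K M c) (k : Idx K) :
    ∃ N₀ : ℕ, ∀ (h m : Idx K) (N N' : ℕ), N₀ ≤ N → N₀ ≤ N' → zwPow K M h c m k =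
      ∑ i ∈ Finset.range N ×ˢ Finset.range N',
        zwCoef h i • c (m.1 + h.1 - i.1, m.2 + h.2 - i.2) (k.1 + i.1, k.2 + i.2) := by
  obtain ⟨N₀, hN₀⟩ := hc.exists_bound_nat k
  refine ⟨N₀, fun h m N N' hN hN' => ?_⟩
  refine finsum_eq_sum_of_support_subset _ fun i hi => ?_
  have := hN₀ (m.1 + h.1 - i.1, m.2 + h.2 - i.2) i fun h₀ => hi (by simp only [h₀, smul_zero])
  simp only [Finset.coe_product, Finset.coe_range, Set.mem_prod, Set.mem_Iio]
  omega

lemma zwPow_add (h : Idx K) {c d : Dist2 K M} (hc : InLat2 K M c) (hd : InLat2 K M d) :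
    zwPow K M h (c + d) = zwPow K M h c + zwPow K M h d := by
  funext m k
  obtain ⟨N₁, h₁⟩ := hc.zwPow_eq_sum k
  obtain ⟨N₂, h₂⟩ := hd.zwPow_eq_sum k
  obtain ⟨N₃, h₃⟩ := (hc.add hd).zwPow_eq_sum k
  let N := max N₁ (max N₂ N₃)
  simp only [Pi.add_apply]
  rw [h₁ h m N N (by omega) (by omega), h₂ h m N N (by omega) (by omega),
    h₃ h m N N (by omega) (by omega), ← Finset.sum_add_distrib]
  simp only [Pi.add_apply, smul_add]

lemma zwPow_zero (h : Idx K) : zwPow K M h 0 = 0 := by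
  funext m k
  simp [zwPow]

lemma zwPow_smul (h : Idx K) (x : K) (c : Dist2 K M) :
    zwPow K M h (x • c) = x • zwPow K M h c := by
  funext m k
  simp only [zwPow, Pi.smul_apply, smul_finsum]
  exact finsum_congr fun i => smul_comm _ _ _

lemma zwPow_sum {ι : Type*} (h : Idx K) (s : Finset ι) {c : ι → Dist2 K M}
    (hc : ∀ i, InLat2 K M (c i)) : zwPow K M h (∑ i ∈ s, c i) = ∑ i ∈ s, zwPow K M h (c i) := by
  classical
  induction s using Finset.induction_on with
  | empty => simp [zwPow_zero]
  | insert i s hi ih =>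
    rw [Finset.sum_insert hi, Finset.sum_insert hi,
      zwPow_add h (hc i) (InLat2.sum s fun j _ => hc j), ih]

lemma zwPowW_eq (h : Idx K) (c : Dist2 K M) :
    zwPowW K M h c = negOnePow K (h.1 - h.2) • swapVars (zwPow K M h (swapVars c)) := by
  funext m k
  simp only [zwPowW, Pi.smul_apply, swapVars, zwPow, smul_finsum, smul_smul, mul_assoc]

lemma zwPow_swapBar (h : Idx K) (c : Dist2 K M) :
    zwPow K M h (swapBar c) = swapBar (zwPow K M h.swap c) := by
  funext m k
  simp only [swapBar, zwPow]
  rw [← finsum_comp_equiv (Equiv.prodComm ℕ ℕ)]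
  refine finsum_congr fun i => ?_
  simp only [Equiv.prodComm_apply, Prod.fst_swap, Prod.snd_swap, Prod.swap_prod_mk]
  congr 1
  ring

/-- Multiplication by `z - w`. -/
def mulZ (c : Dist2 K M) : Dist2 K M := fun n k => c (n + (1, 0)) k - c n (k + (1, 0))

/-- Multiplication by `z̄ - w̄`. -/
def mulZb (c : Dist2 K M) : Dist2 K M := swapBar (mulZ (swapBar c))

lemma InLat2.mulZ {c : Dist2 K M} (hc : InLat2 K M c) : InLat2 K M (mulZ c) := by
  have h₁ := hc.shift (1, 0) 0
  have h₂ := (hc.shift 0 (1, 0)).smul (-1)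
  convert h₁.add h₂ using 1
  funext n k
  simp [OPEA.mulZ, sub_eq_add_neg]

lemma InLat2.mulZb {c : Dist2 K M} (hc : InLat2 K M c) : InLat2 K M (mulZb c) :=
  hc.swapBar.mulZ.swapBar

lemma sum_zwCoef_step (x : K) (d : ℕ → M) (N : ℕ) (hd : d N = 0) :
    ∑ i ∈ Finset.range N, ((-1) ^ i * gchoose K x i) • (d i - d (i + 1)) =
      ∑ i ∈ Finset.range (N + 1), ((-1) ^ i * gchoose K (x + 1) i) • d i := by
  have h : ∑ i ∈ Finset.range N, ((-1) ^ i * gchoose K x i) • d i =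
      ∑ i ∈ Finset.range (N + 1), ((-1) ^ i * gchoose K x i) • d i := by
    rw [Finset.sum_range_succ, hd, smul_zero, add_zero]
  simp only [smul_sub, Finset.sum_sub_distrib]
  rw [h, Finset.sum_range_succ', Finset.sum_range_succ']
  simp only [gchoose_zero, gchoose_add_one]
  rw [add_sub_right_comm, ← Finset.sum_sub_distrib]
  congr 1
  refine Finset.sum_congr rfl fun i _ => ?_
  rw [← sub_smul]
  congr 1
  ring

lemma zwPow_mulZ (h : Idx K) {c : Dist2 K M} (hc : InLat2 K M c) :
    zwPow K M h (mulZ c) = zwPow K M (h + (1, 0)) c := by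
  funext m k
  obtain ⟨N₀, h₀⟩ := hc.exists_bound_nat k
  obtain ⟨N₁, h₁⟩ := hc.zwPow_eq_sum k
  obtain ⟨N₂, h₂⟩ := hc.mulZ.zwPow_eq_sum k
  let N := max N₀ (max N₁ N₂)
  rw [h₁ _ m (N + 1) N (by omega) (by omega), h₂ h m N N (by omega) (by omega),
    Finset.sum_product_right, Finset.sum_product_right]
  refine Finset.sum_congr rfl fun j _ => ?_
  let d : ℕ → M := fun i => ((-1) ^ j * gchoose K h.2 j) •
    c (m.1 + (h.1 + 1) - i, m.2 + h.2 - j) (k.1 + i, k.2 + j)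
  have hd : d N = 0 := by
    by_contra hne
    have := h₀ (m.1 + (h.1 + 1) - N, m.2 + h.2 - j) (N, j) fun h' => hne (by
      simp only [d, h', smul_zero])
    dsimp only at this
    omega
  convert sum_zwCoef_step h.1 d N hd using 2 with i _ i _
  · rw [← smul_sub, smul_smul]
    simp only [zwCoef, mulZ]
    congr 1
    · ring
    · congr 2
      · ext <;> simp; ring
      · ext <;> simp; ring
      · ext <;> simp; ring
  · simp only [d, zwCoef, smul_smul, Prod.fst_add, Prod.snd_add, add_zero]
    congr 1
    ring

lemma zwPow_mulZb (h : Idx K) {c : Dist2 K M} (hc : InLat2 K M c) :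
    zwPow K M h (mulZb c) = zwPow K M (h + (0, 1)) c := by
  rw [mulZb, zwPow_swapBar, zwPow_mulZ _ hc.swapBar, zwPow_swapBar]
  rfl

lemma swapVars_mulZ (c : Dist2 K M) : swapVars (mulZ c) = (-1 : K) • mulZ (swapVars c) := by
  funext n k
  simp [swapVars, mulZ]

lemma swapVars_mulZb (c : Dist2 K M) : swapVars (mulZb c) = (-1 : K) • mulZb (swapVars c) := by
  funext n k
  simp [swapVars, mulZb, mulZ, swapBar]

lemma zwPowW_mulZ {h : Idx K} (hh : Kbar K h) {c : Dist2 K M} (hc : InLat2 K M c) :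
    zwPowW K M h (mulZ c) = zwPowW K M (h + (1, 0)) c := by
  have := negOnePow_add_natCast_sub hh 1 0
  rw [zwPowW_eq, zwPowW_eq, swapVars_mulZ, zwPow_smul, zwPow_mulZ _ hc.swapVars]
  have h₁ : (h + (1, 0)).1 - (h + (1, 0)).2 = h.1 - h.2 + (((1 : ℕ) : K) - ((0 : ℕ) : K)) := by
    simp; ring
  rw [h₁, this]
  funext m k
  simp [swapVars]

lemma zwPowW_mulZb {h : Idx K} (hh : Kbar K h) {c : Dist2 K M} (hc : InLat2 K M c) :
    zwPowW K M h (mulZb c) = zwPowW K M (h + (0, 1)) c := by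
  have := negOnePow_add_natCast_sub hh 0 1
  rw [zwPowW_eq, zwPowW_eq, swapVars_mulZb, zwPow_smul, zwPow_mulZb _ hc.swapVars]
  have h₁ : (h + (0, 1)).1 - (h + (0, 1)).2 = h.1 - h.2 + (((0 : ℕ) : K) - ((1 : ℕ) : K)) := by
    simp; ring
  rw [h₁, this]
  funext m k
  simp [swapVars]

/-- Raising the exponent of a binomial by a pair of natural numbers can be absorbed into the
distribution, uniformly in the two expansions. -/
lemma exists_absorb {h : Idx K} (hh : Kbar K h) (p q : ℕ) {c : Dist2 K M} (hc : InLat2 K M c) :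
    ∃ d : Dist2 K M, InLat2 K M d ∧ zwPow K M h d = zwPow K M (h + ((p : K), (q : K))) c ∧
      zwPowW K M h d = zwPowW K M (h + ((p : K), (q : K))) c := by
  induction p generalizing h with
  | zero =>
    induction q generalizing h with
    | zero => exact ⟨c, hc, by simp [← Prod.zero_eq_mk], by simp [← Prod.zero_eq_mk]⟩
    | succ q ih =>
      have hK : Kbar K (h + (0, 1)) := by
        have := isInt_sub hh (isInt_natCast 1)
        simpa [Kbar, sub_add_eq_sub_sub] using this
      obtain ⟨d, hd, h₁, h₂⟩ := ih hK
      refine ⟨mulZb d, hd.mulZb, ?_, ?_⟩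
      · rw [zwPow_mulZb _ hd, h₁]
        congr 1
        ext <;> simp; ring
      · rw [zwPowW_mulZb hh hd, h₂]
        congr 1
        ext <;> simp; ring
  | succ p ih =>
    have hK : Kbar K (h + (1, 0)) := by
      have := isInt_add hh (isInt_natCast 1)
      simpa [Kbar, add_sub_right_comm] using this
    obtain ⟨d, hd, h₁, h₂⟩ := ih hK
    refine ⟨mulZ d, hd.mulZ, ?_, ?_⟩
    · rw [zwPow_mulZ _ hd, h₁]
      congr 1
      ext <;> simp; ring
    · rw [zwPowW_mulZ hh hd, h₂]
      congr 1
      ext <;> simp; ring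

end Multiplication

section Independence

set_option linter.unusedSectionVars false

variable {K : Type*} [Field K] [CharZero K]

lemma sum_prod_sub_mul_gchoose {ι : Type*} (s : Finset ι) (x : ι → K) (q : ι → K)
    (hq : ∀ l, ∑ i ∈ s, q i * gchoose K (x i) l = 0) (T : Finset K) (l : ℕ) :
    ∑ i ∈ s, q i * (∏ y ∈ T, (x i - y)) * gchoose K (x i) l = 0 := by
  classical
  induction T using Finset.induction_on generalizing l with
  | empty => simpa using hq l
  | insert y T hy ih =>
    have h₁ := ih (l + 1)
    have h₂ := ih l
    calc _ = ((l : K) + 1) * ∑ i ∈ s, q i * (∏ y ∈ T, (x i - y)) * gchoose K (x i) (l + 1) +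
        (l - y) * ∑ i ∈ s, q i * (∏ y ∈ T, (x i - y)) * gchoose K (x i) l := by
          rw [Finset.mul_sum, Finset.mul_sum, ← Finset.sum_add_distrib]
          refine Finset.sum_congr rfl fun i _ => ?_
          rw [Finset.prod_insert hy]
          linear_combination (-(q i * ∏ y ∈ T, (x i - y))) * gchoose_succ_mul (x i) l
      _ = 0 := by rw [h₁, h₂]; simp

/-- The functions `l ↦ C(x, l)` attached to distinct points separate these points. -/
lemma sum_filter_eq_zero_of_sum_gchoose {ι : Type*} (s : Finset ι) (x : ι → K) (q : ι → K)
    (hq : ∀ l, ∑ i ∈ s, q i * gchoose K (x i) l = 0) (y : K) :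
    ∑ i ∈ s with x i = y, q i = 0 := by
  classical
  have h := sum_prod_sub_mul_gchoose s x q hq ((s.image x).erase y) 0
  simp only [gchoose_zero, mul_one] at h
  have h₀ : ∏ z ∈ (s.image x).erase y, (y - z) ≠ 0 :=
    Finset.prod_ne_zero_iff.2 fun z hz => sub_ne_zero.2 (Finset.ne_of_mem_erase hz).symm
  have h₁ : (∑ i ∈ s with x i = y, q i) * ∏ z ∈ (s.image x).erase y, (y - z) = 0 := by
    rw [← h, Finset.sum_mul, Finset.sum_filter]
    refine Finset.sum_congr rfl fun i hi => ?_
    split_ifs with hxy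
    · rw [hxy]
    · rw [Finset.prod_eq_zero (Finset.mem_erase.2 ⟨hxy, Finset.mem_image_of_mem x hi⟩)
        (sub_self _), mul_zero]
  exact (mul_eq_zero.1 h₁).resolve_right h₀

lemma eq_zero_of_sum_gchoose {ι : Type*} (s : Finset ι) (x : ι → Idx K)
    (hx : Set.InjOn x s) (q : ι → K)
    (hq : ∀ l : ℕ × ℕ, ∑ i ∈ s, q i * (gchoose K (x i).1 l.1 * gchoose K (x i).2 l.2) = 0) :
    ∀ i ∈ s, q i = 0 := by
  classical
  intro i hi
  have h₁ : ∀ l', ∑ j ∈ s with (x j).1 = (x i).1, q j * gchoose K (x j).2 l' = 0 := fun l' =>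
    sum_filter_eq_zero_of_sum_gchoose s (fun j => (x j).1) (fun j => q j * gchoose K (x j).2 l')
      (fun l => by rw [← hq (l, l')]; exact Finset.sum_congr rfl fun j _ => by ring) _
  have h₂ := sum_filter_eq_zero_of_sum_gchoose _ (fun j => (x j).2) q h₁ (x i).2
  rw [Finset.filter_filter, Finset.sum_eq_single_of_mem i (by simp [hi])] at h₂
  · exact h₂
  · intro j hj hji
    simp only [Finset.mem_filter] at hj
    exact absurd (hx hj.1 hi (Prod.ext hj.2.1 hj.2.2)) hji

/-- The power series `(1 - X₀)^x (1 - X₁)^x̄`. -/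
def binomSeries (x : Idx K) : MvPowerSeries (Fin 2) K := fun t => zwCoef x (t 0, t 1)

lemma coeff_binomSeries (x : Idx K) (t : Fin 2 →₀ ℕ) :
    MvPowerSeries.coeff t (binomSeries x) = zwCoef x (t 0, t 1) := rfl

lemma one_sub_X_zero_mul_binomSeries (x : Idx K) :
    (1 - MvPowerSeries.X 0) * binomSeries x = binomSeries (x + (1, 0)) := by
  ext t
  rw [sub_mul, one_mul, map_sub, MvPowerSeries.X_def, MvPowerSeries.coeff_monomial_mul]
  simp only [coeff_binomSeries, Finsupp.single_le_iff, one_mul]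
  rcases h : t 0 with _ | n
  · simp [zwCoef, gchoose_zero]
  · simp [zwCoef, gchoose_add_one, h]
    ring

lemma one_sub_X_one_mul_binomSeries (x : Idx K) :
    (1 - MvPowerSeries.X 1) * binomSeries x = binomSeries (x + (0, 1)) := by
  ext t
  rw [sub_mul, one_mul, map_sub, MvPowerSeries.X_def, MvPowerSeries.coeff_monomial_mul]
  simp only [coeff_binomSeries, Finsupp.single_le_iff, one_mul]
  rcases h : t 1 with _ | n
  · simp [zwCoef, gchoose_zero]
  · simp [zwCoef, gchoose_add_one, h]
    ring

lemma pow_mul_binomSeries (x : Idx K) (p q : ℕ) :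
    (1 - MvPowerSeries.X 0) ^ p * (1 - MvPowerSeries.X 1) ^ q * binomSeries x =
      binomSeries (x + ((p : K), (q : K))) := by
  induction p generalizing x with
  | zero =>
    induction q generalizing x with
    | zero => simp [← Prod.zero_eq_mk]
    | succ q ih =>
      rw [pow_succ, ← mul_assoc, mul_assoc, one_sub_X_one_mul_binomSeries, ih]
      congr 1
      ext <;> simp; ring
  | succ p ih =>
    rw [pow_succ, mul_right_comm _ _ (_ ^ q), mul_assoc, one_sub_X_zero_mul_binomSeries, ih]
    congr 1
    ext <;> simp; ring

/-- The involution `X_j ↦ 1 - X_j` of the polynomial ring. -/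
def oneSub : MvPolynomial (Fin 2) K →ₐ[K] MvPolynomial (Fin 2) K :=
  MvPolynomial.aeval fun j => 1 - MvPolynomial.X j

lemma oneSub_oneSub (P : MvPolynomial (Fin 2) K) : oneSub (oneSub P) = P := by
  have : (oneSub.comp oneSub : MvPolynomial (Fin 2) K →ₐ[K] _) = AlgHom.id K _ := by
    ext j
    simp [oneSub]
  exact DFunLike.congr_fun this P

lemma coe_oneSub_mul_binomSeries (Q : MvPolynomial (Fin 2) K) (x : Idx K) :
    (oneSub Q : MvPowerSeries (Fin 2) K) * binomSeries x =
      ∑ e ∈ Q.support, Q.coeff e • binomSeries (x + ((e 0 : K), (e 1 : K))) := by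
  have h : (oneSub Q : MvPowerSeries (Fin 2) K) = ∑ e ∈ Q.support, Q.coeff e •
      ((1 - MvPowerSeries.X 0) ^ e 0 * (1 - MvPowerSeries.X 1) ^ e 1) := by
    have := MvPolynomial.eval₂_eq' (algebraMap K (MvPolynomial (Fin 2) K))
      (fun j => 1 - MvPolynomial.X j) Q
    rw [oneSub, MvPolynomial.aeval_def, this]
    change MvPolynomial.coeToMvPowerSeries.ringHom _ = _
    rw [map_sum]
    refine Finset.sum_congr rfl fun e _ => ?_
    rw [map_mul, Fin.prod_univ_two, map_mul, map_pow, map_pow, map_sub, map_sub, map_one]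
    simp [MvPolynomial.algebraMap_eq, MvPowerSeries.smul_eq_C_mul]
  rw [h, Finset.sum_mul]
  refine Finset.sum_congr rfl fun e _ => ?_
  rw [smul_mul_assoc, pow_mul_binomSeries]

/-- Binomial series with exponents in distinct classes mod `ℤ²` are linearly independent over the
polynomials. -/
lemma eq_zero_of_sum_mul_binomSeries {ι : Type*} [Fintype ι] (x : ι → Idx K)
    (hx : ∀ i j, i ≠ j → ¬ IsIntPair K (x i - x j)) (P : ι → MvPolynomial (Fin 2) K)
    (hP : ∑ i, (P i : MvPowerSeries (Fin 2) K) * binomSeries (x i) = 0) (i : ι) : P i = 0 := by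
  classical
  have hQ : ∀ i, (P i : MvPowerSeries (Fin 2) K) * binomSeries (x i) =
      ∑ e ∈ (oneSub (P i)).support,
        (oneSub (P i)).coeff e • binomSeries (x i + ((e 0 : K), (e 1 : K))) := fun i => by
    rw [← coe_oneSub_mul_binomSeries, oneSub_oneSub]
  simp only [hQ] at hP
  rw [← Finset.sum_sigma Finset.univ (fun i => (oneSub (P i)).support)
    (fun p => (oneSub (P p.1)).coeff p.2 •
      binomSeries (x p.1 + ((p.2 0 : K), (p.2 1 : K))))] at hP
  have key := eq_zero_of_sum_gchoose (Finset.univ.sigma fun i => (oneSub (P i)).support)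
    (fun p => x p.1 + ((p.2 0 : K), (p.2 1 : K))) ?_ (fun p => (oneSub (P p.1)).coeff p.2) ?_
  · have h₀ : oneSub (P i) = 0 := by
      ext e
      by_contra hne
      exact hne (key ⟨i, e⟩ (by simpa [MvPolynomial.mem_support_iff] using hne))
    rw [← oneSub_oneSub (P i), h₀, map_zero]
  · rintro ⟨i, e⟩ - ⟨j, f⟩ - hij
    obtain ⟨h₁, h₂⟩ := Prod.ext_iff.1 hij
    simp only [Prod.fst_add, Prod.snd_add] at h₁ h₂
    obtain rfl : i = j := by
      by_contra hne
      refine hx i j hne ⟨⟨f 0 - e 0, ?_⟩, ⟨f 1 - e 1, ?_⟩⟩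
      · push_cast
        simp only [Prod.fst_sub]
        linear_combination -h₁
      · push_cast
        simp only [Prod.snd_sub]
        linear_combination -h₂
    congr
    ext j
    fin_cases j
    · exact_mod_cast add_left_cancel h₁
    · exact_mod_cast add_left_cancel h₂
  · intro l
    have := congrArg (MvPowerSeries.coeff (Finsupp.equivFunOnFinite.symm ![l.1, l.2])) hP
    simp only [map_sum, map_smul, coeff_binomSeries, zwCoef, map_zero, smul_eq_mul] at this
    have h₁ : ((-1 : K) ^ (l.1 + l.2)) ≠ 0 := pow_ne_zero _ (by simp)
    refine (mul_eq_zero.1 (?_ : (-1 : K) ^ (l.1 + l.2) * _ = 0)).resolve_left h₁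
    rw [← this, Finset.mul_sum]
    refine Finset.sum_congr rfl fun p _ => ?_
    simp
    ring

end Independence

section Uniqueness

set_option linter.unusedSectionVars false

variable {K : Type*} [Field K] [CharZero K] {M : Type*} [AddCommGroup M] [Module K M]

lemma zwPow_eq_sum_antidiagonal (x : Idx K) (c : Dist2 K M) (n k : Idx K)
    (hc : ∀ l l' : ℤ, c (n.1 + l, n.2 + l') (k.1 - l, k.2 - l') ≠ 0 → 0 ≤ l ∧ 0 ≤ l')
    (t : Fin 2 →₀ ℕ) :
    zwPow K M x c (n.1 - x.1 + t 0, n.2 - x.2 + t 1) (k.1 - t 0, k.2 - t 1) =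
      ∑ p ∈ Finset.HasAntidiagonal.antidiagonal t, zwCoef x (p.2 0, p.2 1) •
        c (n.1 + p.1 0, n.2 + p.1 1) (k.1 - p.1 0, k.2 - p.1 1) := by
  classical
  have hinj : Set.InjOn (fun p : (Fin 2 →₀ ℕ) × (Fin 2 →₀ ℕ) => (p.2 0, p.2 1))
      (Finset.HasAntidiagonal.antidiagonal t) := by
    rintro ⟨p, q⟩ hp ⟨p', q'⟩ hp' h
    obtain ⟨h₁, h₂⟩ := Prod.ext_iff.1 h
    have hq : q = q' := by
      ext j
      fin_cases j
      · exact h₁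
      · exact h₂
    subst hq
    have e₁ : p + q = t := Finset.HasAntidiagonal.mem_antidiagonal.1 hp
    have e₂ : p' + q = t := Finset.HasAntidiagonal.mem_antidiagonal.1 hp'
    rw [add_right_cancel (e₁.trans e₂.symm)]
  have hterm : ∀ l : ℕ × ℕ, zwCoef x l •
      c (n.1 - x.1 + t 0 + x.1 - l.1, n.2 - x.2 + t 1 + x.2 - l.2)
        (k.1 - t 0 + l.1, k.2 - t 1 + l.2) =
      zwCoef x l • c (n.1 + ((t 0 - l.1 : ℤ) : K), n.2 + ((t 1 - l.2 : ℤ) : K))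
        (k.1 - ((t 0 - l.1 : ℤ) : K), k.2 - ((t 1 - l.2 : ℤ) : K)) := by
    intro l
    congr 3
    all_goals push_cast; ring
  calc _ = ∑ᶠ l : ℕ × ℕ, zwCoef x l •
        c (n.1 + ((t 0 - l.1 : ℤ) : K), n.2 + ((t 1 - l.2 : ℤ) : K))
          (k.1 - ((t 0 - l.1 : ℤ) : K), k.2 - ((t 1 - l.2 : ℤ) : K)) := finsum_congr hterm
    _ = ∑ l ∈ (Finset.HasAntidiagonal.antidiagonal t).image (fun p => (p.2 0, p.2 1)), zwCoef x l •
        c (n.1 + ((t 0 - l.1 : ℤ) : K), n.2 + ((t 1 - l.2 : ℤ) : K))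
          (k.1 - ((t 0 - l.1 : ℤ) : K), k.2 - ((t 1 - l.2 : ℤ) : K)) := by
      refine finsum_eq_sum_of_support_subset _ fun l hl => ?_
      obtain ⟨h₁, h₂⟩ := hc _ _ (right_ne_zero_of_smul (Function.mem_support.1 hl))
      have hle : Finsupp.equivFunOnFinite.symm ![l.1, l.2] ≤ t := by
        intro j
        fin_cases j
        · simp; omega
        · simp; omega
      refine Finset.mem_coe.2 (Finset.mem_image.2
        ⟨(t - Finsupp.equivFunOnFinite.symm ![l.1, l.2],
          Finsupp.equivFunOnFinite.symm ![l.1, l.2]), ?_, ?_⟩)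
      · exact Finset.HasAntidiagonal.mem_antidiagonal.2 (tsub_add_cancel_of_le hle)
      · simp
    _ = _ := by
      rw [Finset.sum_image hinj]
      refine Finset.sum_congr rfl fun p hp => ?_
      rw [← Finset.HasAntidiagonal.mem_antidiagonal.1 hp]
      simp

/-- Distributions `c i` are determined by `∑ i, (𝐳 - 𝐰)^{-h i} c i` if the exponents are reduced. -/
lemma eq_zero_of_sum_zwPow {ι : Type*} [Fintype ι] (h : ι → Idx K)
    (hred : ∀ i j, i ≠ j → ¬ IsIntPair K (h i - h j)) (c : ι → Dist2 K M)
    (hc : ∀ i, InLat2 K M (c i)) (h₀ : ∑ i, zwPow K M (-(h i)) (c i) = 0) (i : ι) : c i = 0 := by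
  classical
  funext n k
  refine (Module.forall_dual_apply_eq_zero_iff K _).1 fun φ => ?_
  choose N hN using fun j => (hc j).exists_bound_right k
  let B := Finset.univ.sup N
  have hB : ∀ j, N j ≤ B := fun j => Finset.le_sup (Finset.mem_univ j)
  let n' : ι → Idx K := fun j => (n.1 + (h i).1 - (h j).1 - B, n.2 + (h i).2 - (h j).2 - B)
  let k' : Idx K := (k.1 + B, k.2 + B)
  have hlow : ∀ j (l l' : ℤ), c j ((n' j).1 + l, (n' j).2 + l') (k'.1 - l, k'.2 - l') ≠ 0 →
      0 ≤ l ∧ 0 ≤ l' := by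
    intro j l l' hne
    have e : (k'.1 - (l : K), k'.2 - (l' : K)) =
        (k.1 + ((B - l : ℤ) : K), k.2 + ((B - l' : ℤ) : K)) := by
      ext <;> simp [k'] <;> ring
    rw [e] at hne
    have := hN j _ _ _ hne
    have := hB j
    omega
  let u : ι → (Fin 2 →₀ ℕ) → K := fun j s =>
    φ (c j ((n' j).1 + s 0, (n' j).2 + s 1) (k'.1 - s 0, k'.2 - s 1))
  have hfin : ∀ j, (Function.support (u j)).Finite := by
    intro j
    obtain ⟨N', hN'⟩ := (hc j).exists_bound_left (n' j)
    refine (Set.finite_Iic (Finsupp.equivFunOnFinite.symm fun _ => N')).subset fun s hs => ?_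
    have := hN' (k'.1 - s 0, k'.2 - s 1) (s 0) (s 1) fun hz => hs (by
      simp only [Int.cast_natCast] at hz
      simp only [u, hz, map_zero])
    intro a
    fin_cases a
    · simp; omega
    · simp; omega
  let P : ι → MvPolynomial (Fin 2) K := fun j =>
    AddMonoidAlgebra.ofCoeff (Finsupp.ofSupportFinite (u j) (hfin j))
  have hPc : ∀ j s, (P j).coeff s = u j s := fun j s => rfl
  have hP : ∑ j, (P j : MvPowerSeries (Fin 2) K) * binomSeries (-(h j)) = 0 := by
    ext t
    have ht := congrArg φ (congrFun (congrFun h₀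
      (n.1 + (h i).1 - B + t 0, n.2 + (h i).2 - B + t 1)) (k'.1 - t 0, k'.2 - t 1))
    rw [map_sum, map_zero]
    simp only [Finset.sum_apply, map_sum, Pi.zero_apply, map_zero] at ht
    rw [← ht]
    refine Finset.sum_congr rfl fun j _ => ?_
    have e : (n.1 + (h i).1 - B + t 0, n.2 + (h i).2 - B + t 1) =
        ((n' j).1 - (-(h j)).1 + t 0, (n' j).2 - (-(h j)).2 + t 1) := by
      ext <;> simp [n'] <;> ring
    rw [e, zwPow_eq_sum_antidiagonal _ _ _ _ (hlow j), map_sum, MvPowerSeries.coeff_mul]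
    refine Finset.sum_congr rfl fun p _ => ?_
    rw [map_smul, MvPolynomial.coeff_coe, hPc, coeff_binomSeries, smul_eq_mul, mul_comm]
  have hzero := eq_zero_of_sum_mul_binomSeries (fun j => -(h j)) (fun a b hab hint => by
    refine hred b a hab.symm ?_
    rwa [neg_sub_neg] at hint) P hP i
  have hval := hPc i (Finsupp.equivFunOnFinite.symm fun _ => B)
  rw [hzero] at hval
  simp only [u, n', k', MvPolynomial.coeff_zero] at hval
  rw [hval]
  simp

/-- Analogue of `eq_zero_of_sum_zwPow` for the opposite expansion. -/
lemma eq_zero_of_sum_zwPowW {ι : Type*} [Fintype ι] (h : ι → Idx K)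
    (hK : ∀ i, Kbar K (h i)) (hred : ∀ i j, i ≠ j → ¬ IsIntPair K (h i - h j))
    (c : ι → Dist2 K M) (hc : ∀ i, InLat2 K M (c i))
    (h₀ : ∑ i, zwPowW K M (-(h i)) (c i) = 0) (i : ι) : c i = 0 := by
  have hne : ∀ i, negOnePow K ((-(h i)).1 - (-(h i)).2) ≠ 0 := fun i =>
    negOnePow_ne_zero (hK i).neg
  have key := eq_zero_of_sum_zwPow h hred
    (fun i => negOnePow K ((-(h i)).1 - (-(h i)).2) • swapVars (c i))
    (fun i => (hc i).swapVars.smul _) ?_ i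
  · have := (smul_eq_zero.1 key).resolve_left (hne i)
    funext n k
    exact congrFun (congrFun this k) n
  · funext m k
    have := congrFun (congrFun h₀ k) m
    simpa [zwPow_smul, zwPowW_eq, swapVars] using this

lemma exists_rep : ∃ rep : K → K, (∀ x, IsInt K (rep x - x)) ∧
    ∀ x y, IsInt K (x - y) → rep x = rep y := by
  let s : Setoid K :=
    { r := fun x y => IsInt K (x - y)
      iseqv :=
        { refl := fun x => ⟨0, by simp⟩
          symm := fun {x y} h => by simpa using isInt_sub (isInt_natCast 0) h
          trans := fun {x y z} h h' => by simpa using isInt_add h h' } }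
  exact ⟨fun x => (Quotient.mk s x).out, fun x => Quotient.mk_out (s := s) x,
    fun x y h => by dsimp only; rw [show Quotient.mk s x = Quotient.mk s y from Quotient.sound h]⟩

/-- Exponents can be raised by natural numbers so that congruent ones become equal. -/
lemma exists_reduced_exponents {ι : Type*} [Fintype ι] (h : ι → Idx K) :
    ∃ (H : ι → Idx K) (p q : ι → ℕ), (∀ i, H i = h i + ((p i : K), (q i : K))) ∧
      ∀ i j, IsIntPair K (H i - H j) → H i = H j := by
  obtain ⟨rep, hrep, heq⟩ := exists_rep (K := K)
  choose d hd using hrep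
  let D : ℕ := ∑ i, ((d (h i).1).natAbs + (d (h i).2).natAbs)
  have hD : ∀ i, (d (h i).1).natAbs + (d (h i).2).natAbs ≤ D := fun i =>
    Finset.single_le_sum (f := fun i => (d (h i).1).natAbs + (d (h i).2).natAbs)
      (fun _ _ => Nat.zero_le _) (Finset.mem_univ i)
  have hcast : ∀ x : K, (d x).natAbs ≤ D → rep x + D = x + ((d x + D).toNat : K) := by
    intro x hx
    have h₁ : (((d x + D).toNat : ℤ) : K) = ((d x + D : ℤ) : K) := by
      rw [Int.toNat_of_nonneg (by omega)]
    rw [Int.cast_natCast] at h₁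
    rw [h₁]
    push_cast
    rw [hd]
    ring
  have hrr : ∀ x y, IsInt K (rep x - rep y) → rep x = rep y := by
    intro x y hxy
    refine heq x y ?_
    have h₁ := isInt_sub hxy (isInt_sub ⟨d x, hd x⟩ ⟨d y, hd y⟩)
    convert h₁ using 1
    ring
  refine ⟨fun i => (rep (h i).1 + D, rep (h i).2 + D), fun i => (d (h i).1 + D).toNat,
    fun i => (d (h i).2 + D).toNat, fun i => ?_, fun i j hij => ?_⟩
  · have := hD i
    ext
    · exact hcast _ (by omega)
    · exact hcast _ (by omega)
  · obtain ⟨h₁, h₂⟩ := hij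
    simp only [Prod.fst_sub, Prod.snd_sub, add_sub_add_right_eq_sub] at h₁ h₂
    dsimp only
    rw [hrr _ _ h₁, hrr _ _ h₂]

/-- If an OPE vanishes in the region `w > z`, then it vanishes in the region `z > w`. -/
lemma sum_zwPow_eq_zero_of_sum_zwPowW {ι : Type*} [Fintype ι] (h : ι → Idx K)
    (hK : ∀ i, Kbar K (h i)) (c : ι → Dist2 K M) (hc : ∀ i, InLat2 K M (c i))
    (h₀ : ∑ i, zwPowW K M (-(h i)) (c i) = 0) : ∑ i, zwPow K M (-(h i)) (c i) = 0 := by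
  classical
  obtain ⟨H, p, q, hH, hinj⟩ := exists_reduced_exponents h
  have hHK : ∀ i, Kbar K (H i) := fun i => by
    rw [hH]
    exact (kbar_add_iff (kbar_natCast _ _) _).2 (hK i)
  choose d hd hz hw using fun i => exists_absorb (hHK i).neg (p i) (q i) (hc i)
  have hexp : ∀ i, -(H i) + ((p i : K), (q i : K)) = -(h i) := fun i => by
    rw [hH]
    abel
  simp only [hexp] at hz hw
  let C : Finset.univ.image H → Dist2 K M := fun x => ∑ i with H i = x, d i
  have hC : ∀ x, InLat2 K M (C x) := fun x => InLat2.sum _ fun i _ => hd i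
  have hgroup : ∀ F : Idx K → Dist2 K M → Dist2 K M,
      (∀ (x : Idx K) (s : Finset ι), F x (∑ i ∈ s, d i) = ∑ i ∈ s, F x (d i)) →
      ∑ x : Finset.univ.image H, F (-(x : Idx K)) (C x) = ∑ i, F (-(H i)) (d i) := by
    intro F hF
    rw [Finset.sum_coe_sort (Finset.univ.image H)
      (fun x => F (-x) (∑ i with H i = x, d i))]
    rw [← Finset.sum_fiberwise_of_maps_to (s := Finset.univ) (t := Finset.univ.image H) (g := H)
      (fun i hi => Finset.mem_image_of_mem H hi)]
    refine Finset.sum_congr rfl fun x _ => ?_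
    rw [hF]
    refine Finset.sum_congr rfl fun i hi => ?_
    rw [(Finset.mem_filter.1 hi).2]
  have hCz : ∀ x, C x = 0 := by
    refine eq_zero_of_sum_zwPowW (fun x : Finset.univ.image H => (x : Idx K)) ?_ ?_ C hC ?_
    · rintro ⟨x, hx⟩
      obtain ⟨i, -, rfl⟩ := Finset.mem_image.1 hx
      exact hHK i
    · rintro ⟨x, hx⟩ ⟨y, hy⟩ hxy hint
      obtain ⟨i, -, rfl⟩ := Finset.mem_image.1 hx
      obtain ⟨j, -, rfl⟩ := Finset.mem_image.1 hy
      exact hxy (Subtype.ext (hinj i j hint))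
    · rw [hgroup (zwPowW K M), ← h₀]
      · exact Finset.sum_congr rfl fun i _ => hw i
      · intro x s
        have : swapVars (∑ i ∈ s, d i) = ∑ i ∈ s, swapVars (d i) := by
          funext m k
          simp [swapVars]
        simp only [zwPowW_eq]
        rw [this, zwPow_sum x s fun i => (hd i).swapVars, ← Finset.smul_sum]
        congr 1
        funext m k
        simp [swapVars]
  rw [← Finset.sum_congr rfl fun i _ => hz i,
    ← hgroup (zwPow K M) fun x s => zwPow_sum x s hd]
  simp [hCz, zwPow_zero]

lemma zwPow_trunc_left {h : Idx K} (hh : Kbar K h) (c : Dist2 K M) (m k : Idx K) :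
    zwPow K M h (fun n l => if Kbar K n then 0 else c n l) m k =
      if Kbar K m then 0 else zwPow K M h c m k := by
  have hP : ∀ i : ℕ × ℕ, Kbar K (m.1 + h.1 - i.1, m.2 + h.2 - i.2) ↔ Kbar K m := fun i => by
    rw [← kbar_add_iff hh m, ← kbar_add_iff (kbar_natCast i.1 i.2).neg (m + h)]
    simp only [sub_eq_add_neg]
    rfl
  simp only [zwPow, hP]
  split_ifs <;> simp

lemma zwPow_trunc_right (h : Idx K) (c : Dist2 K M) (m k : Idx K) :
    zwPow K M h (fun n l => if Kbar K l then 0 else c n l) m k =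
      if Kbar K k then 0 else zwPow K M h c m k := by
  have hP : ∀ i : ℕ × ℕ, Kbar K (k.1 + i.1, k.2 + i.2) ↔ Kbar K k := fun i =>
    kbar_add_iff (kbar_natCast i.1 i.2) k
  simp only [zwPow, hP]
  split_ifs <;> simp

lemma zwPowW_trunc_left (h : Idx K) (c : Dist2 K M) (m k : Idx K) :
    zwPowW K M h (fun n l => if Kbar K n then 0 else c n l) m k =
      if Kbar K m then 0 else zwPowW K M h c m k := by
  have hP : ∀ i : ℕ × ℕ, Kbar K (m.1 + i.1, m.2 + i.2) ↔ Kbar K m := fun i =>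
    kbar_add_iff (kbar_natCast i.1 i.2) m
  simp only [zwPowW, hP]
  split_ifs <;> simp

lemma InLat2.inLat1_zwPow {c : Dist2 K M} (hc : InLat2 K M c) (h k : Idx K) :
    InLat1 K M (fun n => zwPow K M h c n k) := by
  classical
  obtain ⟨N, hN⟩ := hc.exists_bound_nat k
  obtain ⟨S, hS⟩ := hc
  refine ⟨(S ×ˢ (Finset.range N ×ˢ Finset.range N)).image fun x =>
    (x.1.1.1 - h.1 + x.2.1, x.1.1.2 - h.2 + x.2.2), fun n hn => ?_⟩
  obtain ⟨i, hi⟩ : ∃ i : ℕ × ℕ, zwCoef h i •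
      c (n.1 + h.1 - i.1, n.2 + h.2 - i.2) (k.1 + i.1, k.2 + i.2) ≠ 0 := by
    by_contra! h₀
    exact hn ((finsum_congr h₀).trans finsum_zero)
  have hi' := right_ne_zero_of_smul hi
  obtain ⟨m, hm, ⟨h₁, h₂⟩, -⟩ := hS _ _ hi'
  have hlt := hN _ i hi'
  refine ⟨_, Finset.mem_image.2 ⟨(m, i), ?_, rfl⟩, ?_, ?_⟩
  · simp [hm, hlt]
  · convert h₁ using 1
    ring
  · convert h₂ using 1
    ring

lemma InLat1.add {a b : Dist1 K M} (ha : InLat1 K M a) (hb : InLat1 K M b) :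
    InLat1 K M (a + b) := by
  classical
  obtain ⟨S, hS⟩ := ha
  obtain ⟨S', hS'⟩ := hb
  refine ⟨S ∪ S', fun n h => ?_⟩
  by_cases h₀ : a n = 0
  · obtain ⟨m, hm, H⟩ := hS' n (by simpa [h₀] using h)
    exact ⟨m, Finset.mem_union_right _ hm, H⟩
  · obtain ⟨m, hm, H⟩ := hS n h₀
    exact ⟨m, Finset.mem_union_left _ hm, H⟩

lemma InLat1.sum {ι : Type*} (s : Finset ι) {a : ι → Dist1 K M}
    (ha : ∀ i ∈ s, InLat1 K M (a i)) : InLat1 K M (∑ i ∈ s, a i) :=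
  Finset.sum_induction _ _ (fun _ _ => InLat1.add) ⟨∅, fun _ h => absurd rfl h⟩ ha

end Uniqueness

section OPEAlgebra

variable {K : Type*} [Field K] [CharZero K] {V : Type*} [AddCommGroup V] [Module K V]

@[elab_as_elim]
lemma OPEAlg.homogeneous_induction (A : OPEAlg K V) {P : V → Prop}
    (hhom : ∀ a p, memPar K A.ev A.od a p → P a) (hadd : ∀ a b, P a → P b → P (a + b)) (a : V) :
    P a := by
  obtain ⟨x, hx, y, hy, rfl⟩ := Submodule.mem_sup.1 (A.compl.sup_eq_top ▸ Submodule.mem_top :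
    a ∈ A.ev ⊔ A.od)
  exact hadd x y (hhom x 0 (Or.inl ⟨rfl, hx⟩)) (hhom y 1 (Or.inr ⟨rfl, hy⟩))

lemma OPEAlg.inLat1 (A : OPEAlg K V) (a v : V) : InLat1 K V (ev1 K V (A.Y a) v) := by
  refine A.homogeneous_induction (fun a pa ha => ?_) (fun a a' h h' => ?_) a
  · refine A.homogeneous_induction (fun v pv hv => ?_) (fun v v' h h' => ?_) v
    · obtain ⟨r, c, h, -, hc, hz, -⟩ := A.loc a v pa pv ha hv
      have heq : ev1 K V (A.Y a) v =
          ∑ i, fun n => zwPow K V (-(h i)) (ev2 K V (c i) A.one) n (-1, -1) := by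
        funext n
        rw [Finset.sum_apply, ← hz, A.rid, ev1]
      rw [heq]
      exact InLat1.sum _ fun i _ => (hc i A.one).inLat1_zwPow _ _
    · have heq : ev1 K V (A.Y a) (v + v') = ev1 K V (A.Y a) v + ev1 K V (A.Y a) v' :=
        funext fun n => map_add _ _ _
      rw [heq]
      exact h.add h'
  · have heq : ev1 K V (A.Y (a + a')) v = ev1 K V (A.Y a) v + ev1 K V (A.Y a') v :=
      funext fun n => by simp [ev1]
    rw [heq]
    exact h.add h'

lemma OPEAlg.apply_eq_zero (A : OPEAlg K V) (a : V) {n : Idx K} (hn : ¬ Kbar K n) (v : V) :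
    A.Y a n v = 0 := by
  refine A.homogeneous_induction (fun a pa ha => ?_) (fun a a' h h' => ?_) a
  · refine A.homogeneous_induction (fun v pv hv => ?_) (fun v v' h h' => ?_) v
    · obtain ⟨r, c, h, hK, hc, hz, hw⟩ := A.loc a v pa pv ha hv
      have hzero := sum_zwPow_eq_zero_of_sum_zwPowW h hK
        (fun i n l => if Kbar K n then 0 else ev2 K V (c i) A.one n l)
        (fun i => (hc i A.one).trunc fun n _ => Kbar K n) ?_
      · have := congrFun (congrFun hzero n) (-1, -1)
        simpa only [Finset.sum_apply, zwPow_trunc_left (hK _).neg, if_neg hn, ← hz, A.rid,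
          Pi.zero_apply] using this
      · funext m k
        simp only [Finset.sum_apply, zwPowW_trunc_left, Pi.zero_apply]
        by_cases hm : Kbar K m
        · simp [hm]
        · have hcre : A.Y a m A.one = 0 := by
            by_contra hne
            obtain ⟨h₁, h₂⟩ := A.wcre a m hne
            exact hm (isInt_sub h₁.isInt h₂.isInt)
          simp only [if_neg hm, ← hw, hcre, map_zero, smul_zero]
    · rw [map_add, h, h', add_zero]
  · rw [map_add, Pi.add_apply, LinearMap.add_apply, h, h', add_zero]

lemma OPEAlg.ope_support (A : OPEAlg K V) {a b : V} {pa pb : ZMod 2} {r : ℕ}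
    {c : Fin r → EDist2 K V} {h : Fin r → Idx K} (hope : IsOPE K V pa pb (A.Y a) (A.Y b) c h)
    (hred : ReducedExp K h) (i : Fin r) (v : V) (m k : Idx K) (hne : c i m k v ≠ 0) :
    Kbar K m ∧ Kbar K k := by
  obtain ⟨hK, hc, hz, -⟩ := hope
  constructor
  · by_contra hm
    have := eq_zero_of_sum_zwPow h hred
      (fun i n l => if Kbar K n then 0 else ev2 K V (c i) v n l)
      (fun i => (hc i v).trunc fun n _ => Kbar K n) ?_ i
    · exact hne (by simpa [hm, ev2] using congrFun (congrFun this m) k)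
    · funext n l
      simp only [Finset.sum_apply, zwPow_trunc_left (hK _).neg, Pi.zero_apply]
      by_cases hn : Kbar K n
      · simp [hn]
      · simp only [if_neg hn, ← hz, A.apply_eq_zero a hn]
  · by_contra hk
    have := eq_zero_of_sum_zwPow h hred
      (fun i n l => if Kbar K l then 0 else ev2 K V (c i) v n l)
      (fun i => (hc i v).trunc fun _ l => Kbar K l) ?_ i
    · exact hne (by simpa [hk, ev2] using congrFun (congrFun this m) k)
    · funext n l
      simp only [Finset.sum_apply, zwPow_trunc_right, Pi.zero_apply]
      by_cases hl : Kbar K l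
      · simp [hl]
      · simp only [if_neg hl, ← hz, A.apply_eq_zero b hl, map_zero]

end OPEAlgebra

/-- every OPE-algebra is a bounded 𝕂̄-fold algebra, and in any
reduced OPE of homogeneous elements of F_Y each c^i(𝐳,𝐰)v is supported in 𝕂̄ × 𝕂̄. -/
theorem stmt_6 (K : Type*) [Field K] [CharZero K]
    (V : Type*) [AddCommGroup V] [Module K V]
    (A : OPEAlg K V) :
    (∀ (a v : V), InLat1 K V (ev1 K V (A.Y a) v)) ∧
    (∀ (a : V) (n : Idx K), ¬ Kbar K n → ∀ b : V, A.Y a n b = 0) ∧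
    (∀ (a b : V) (pa pb : ZMod 2), memPar K A.ev A.od a pa → memPar K A.ev A.od b pb →
      ∀ {r : ℕ} (c : Fin r → EDist2 K V) (h : Fin r → Idx K),
        IsOPE K V pa pb (A.Y a) (A.Y b) c h → ReducedExp K h →
        ∀ (i : Fin r) (v : V) (m k : Idx K),
          c i m k v ≠ 0 → Kbar K m ∧ Kbar K k) := by
  exact ⟨A.inLat1, fun a _ hn b => A.apply_eq_zero a hn b,
    fun a b pa pb _ _ _ c h hope hred i v m k hne => A.ope_support hope hred i v m k hne⟩

end OPEA
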